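/- Let G be a nonempty closed L⁰-convex subset of L⁰(𝓕,B). Suppose there exist a sequence (x_n)_{n≥1} in G and c ∈ L⁰(𝓕) with c(ω) > 0 a.s. such that ‖x_n − x_m‖ ≤ c for all n, m ≥ 1 and ‖x_{n+1} − x̄_n‖ ≥ c − 1/n² for all n ≥ 1 (inequalities in L⁰(𝓕)), where x̄_n := (1/n)·Σ_{i=1}^{n} x_i. Then G does not have random normal structure. -/

import Mathlib

open MeasureTheory Set Filter Function
open scoped Classical

noncomputable section

namespace RNM


variable {Ω : Type*} [MeasurableSpace Ω] {P : Measure Ω}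
variable {B : Type*} [NormedAddCommGroup B] [NormedSpace ℝ B]

/-- The pointwise norm of `x ∈ L⁰(𝓕,B)` as an element of `L⁰(𝓕,ℝ)`. -/
def nrm (x : Ω →ₘ[P] B) : Ω →ₘ[P] ℝ := x.comp norm continuous_norm

/-- The module action of `L⁰(𝓕,ℝ)` on `L⁰(𝓕,B)` (pointwise scalar multiplication). -/
def msmul (l : Ω →ₘ[P] ℝ) (x : Ω →ₘ[P] B) : Ω →ₘ[P] B :=
  AEEqFun.comp₂ (fun c (b : B) => c • b) continuous_smul l x

/-- `Ĩ_A`, the equivalence class of the indicator function of `A`, in `L⁰(𝓕,ℝ)`. -/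
def ind (A : Set Ω) (hA : MeasurableSet A) : Ω →ₘ[P] ℝ :=
  AEEqFun.mk (A.indicator fun _ => (1 : ℝ))
    ((measurable_const.indicator hA).aestronglyMeasurable)

/-- A subset of `L⁰(𝓕,B)` is a.s. bounded if the norms of its members have a common
bound in `L⁰(𝓕,ℝ)`. -/
def ASBounded (H : Set (Ω →ₘ[P] B)) : Prop :=
  ∃ ξ : Ω →ₘ[P] ℝ, ∀ h ∈ H, nrm h ≤ ξ

/-- The supremum of a subset of `L⁰(𝓕,ℝ)` (junk value `0` if no least upper bound exists;
for nonempty a.s. bounded-above sets the least upper bound always exists, by Dedekind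
completeness of `L⁰(𝓕,ℝ)`). -/
def lsup (S : Set (Ω →ₘ[P] ℝ)) : Ω →ₘ[P] ℝ :=
  if h : ∃ ξ, IsLUB S ξ then h.choose else 0

/-- The infimum of a subset of `L⁰(𝓕,ℝ)` (junk value `0` if no greatest lower bound exists). -/
def linf (S : Set (Ω →ₘ[P] ℝ)) : Ω →ₘ[P] ℝ :=
  if h : ∃ ξ, IsGLB S ξ then h.choose else 0

/-- The random Chebyshev radius `R(H,x)` of `H` at `x`. -/
def Rr (H : Set (Ω →ₘ[P] B)) (x : Ω →ₘ[P] B) : Ω →ₘ[P] ℝ :=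
  lsup ((fun y => nrm (x - y)) '' H)

/-- The random Chebyshev radius `R(H,G)` of `H` with respect to `G`. -/
def RrS (H G : Set (Ω →ₘ[P] B)) : Ω →ₘ[P] ℝ :=
  linf ((fun x => Rr H x) '' G)

/-- The random Chebyshev center `C(H,G)` of `H` with respect to `G`. -/
def Cc (H G : Set (Ω →ₘ[P] B)) : Set (Ω →ₘ[P] B) :=
  {x ∈ G | Rr H x = RrS H G}

/-- The random diameter `D(H)`. -/
def Dd (H : Set (Ω →ₘ[P] B)) : Ω →ₘ[P] ℝ :=
  lsup {ξ | ∃ x ∈ H, ∃ y ∈ H, ξ = nrm (x - y)}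

/-- A subset of `L⁰(𝓕,B)` is closed if it is sequentially closed under convergence in
probability (the `(ε,λ)`-topology). -/
def SeqClosed (S : Set (Ω →ₘ[P] B)) : Prop :=
  ∀ (x : ℕ → Ω →ₘ[P] B) (y : Ω →ₘ[P] B), (∀ n, x n ∈ S) →
    TendstoInMeasure P (fun n => (x n : Ω → B)) atTop y → y ∈ S

/-- The closure of a subset of `L⁰(𝓕,B)` under convergence in probability. -/
def seqClosure (S : Set (Ω →ₘ[P] B)) : Set (Ω →ₘ[P] B) :=
  {y | ∃ x : ℕ → Ω →ₘ[P] B, (∀ n, x n ∈ S) ∧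
    TendstoInMeasure P (fun n => (x n : Ω → B)) atTop y}

/-- `L⁰`-convexity. -/
def LConvex (G : Set (Ω →ₘ[P] B)) : Prop :=
  ∀ x ∈ G, ∀ y ∈ G, ∀ l : Ω →ₘ[P] ℝ, 0 ≤ l → l ≤ 1 →
    msmul l x + msmul (1 - l) y ∈ G

/-- `L⁰`-convex compactness: `G` is a nonempty closed `L⁰`-convex set such that every family
of nonempty closed `L⁰`-convex subsets of `G` with the finite intersection property has
nonempty intersection. -/
def ConvexlyCompact (G : Set (Ω →ₘ[P] B)) : Prop :=
  G.Nonempty ∧ SeqClosed G ∧ LConvex G ∧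
    ∀ 𝒞 : Set (Set (Ω →ₘ[P] B)),
      (∀ C ∈ 𝒞, C.Nonempty ∧ C ⊆ G ∧ SeqClosed C ∧ LConvex C) →
      (∀ S : Finset (Set (Ω →ₘ[P] B)), ↑S ⊆ 𝒞 → (⋂₀ (S : Set (Set (Ω →ₘ[P] B)))).Nonempty) →
      (⋂₀ 𝒞).Nonempty

/-- Random normal structure. -/
def RandNormalStructure (G : Set (Ω →ₘ[P] B)) : Prop :=
  ∀ H ⊆ G, H.Nonempty → ASBounded H → SeqClosed H → LConvex H → Dd H ≠ 0 →
    ∃ z ∈ H, ∀ᵐ ω ∂P, 0 < Dd H ω → Rr H z ω < Dd H ω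

/-- A nonexpansive mapping (on `G`). -/
def NonexpansiveOn (G : Set (Ω →ₘ[P] B)) (T : (Ω →ₘ[P] B) → (Ω →ₘ[P] B)) : Prop :=
  ∀ x ∈ G, ∀ y ∈ G, nrm (T x - T y) ≤ nrm (x - y)

/-- An isometric mapping (on `G`). -/
def IsometricOn (G : Set (Ω →ₘ[P] B)) (T : (Ω →ₘ[P] B) → (Ω →ₘ[P] B)) : Prop :=
  ∀ x ∈ G, ∀ y ∈ G, nrm (T x - T y) = nrm (x - y)

/-- A countable measurable partition of `Ω`. -/
def IsPartition (A : ℕ → Set Ω) : Prop :=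
  (∀ n, MeasurableSet (A n)) ∧ Pairwise (Disjoint on A) ∧ (⋃ n, A n) = univ

/-- `y` is the countable concatenation `Σ_n Ĩ_{A_n} x_n`,
i.e. `y` agrees a.s. with `x n` on `A n` for each `n`. -/
def IsConcat (A : ℕ → Set Ω) (x : ℕ → Ω →ₘ[P] B) (y : Ω →ₘ[P] B) : Prop :=
  ∀ n, ∀ᵐ ω ∂P, ω ∈ A n → y ω = x n ω

/-- `G` is σ-stable: it contains all countable concatenations of its members along
countable measurable partitions of `Ω`. -/
def SigmaStable (G : Set (Ω →ₘ[P] B)) : Prop :=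
  ∀ A : ℕ → Set Ω, IsPartition A → ∀ x : ℕ → Ω →ₘ[P] B, (∀ n, x n ∈ G) →
    ∀ y, IsConcat A x y → y ∈ G

/-- The σ-stable hull of `G`. -/
def sigmaHull (G : Set (Ω →ₘ[P] B)) : Set (Ω →ₘ[P] B) :=
  {y | ∃ A : ℕ → Set Ω, IsPartition A ∧
    ∃ x : ℕ → Ω →ₘ[P] B, (∀ n, x n ∈ G) ∧ IsConcat A x y}

/-- The countable concatenation `Σ_n Ĩ_{A_n} H_n` of a sequence of sets. -/
def concatSet (A : ℕ → Set Ω) (H : ℕ → Set (Ω →ₘ[P] B)) : Set (Ω →ₘ[P] B) :=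
  {y | ∃ x : ℕ → Ω →ₘ[P] B, (∀ n, x n ∈ H n) ∧ IsConcat A x y}

/-- A finitely stable subset of `L⁰(𝓕,B)`. -/
def FinStable (G : Set (Ω →ₘ[P] B)) : Prop :=
  ∀ x ∈ G, ∀ y ∈ G, ∀ A : Set Ω, ∀ hA : MeasurableSet A,
    msmul (ind A hA) x + msmul (ind Aᶜ hA.compl) y ∈ G

theorem nrm_coe {Ω : Type*} [MeasurableSpace Ω] {P : Measure Ω}
    {B : Type*} [NormedAddCommGroup B] (x : Ω →ₘ[P] B) :
    ∀ᵐ ω ∂P, nrm x ω = ‖x ω‖ :=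
  AEEqFun.coeFn_comp _ continuous_norm x

theorem nrm_sub_le_iff {Ω : Type*} [MeasurableSpace Ω] {P : Measure Ω}
    {B : Type*} [NormedAddCommGroup B] (x y : Ω →ₘ[P] B) (c : Ω →ₘ[P] ℝ) :
    nrm (x - y) ≤ c ↔ ∀ᵐ ω ∂P, ‖x ω - y ω‖ ≤ c ω := by
  rw [← AEEqFun.coeFn_le]
  constructor
  · intro h
    filter_upwards [h, nrm_coe (x - y), AEEqFun.coeFn_sub x y] with ω h1 h2 h3
    rw [h2, h3] at h1
    exact h1
  · intro h
    filter_upwards [h, nrm_coe (x - y), AEEqFun.coeFn_sub x y] with ω h1 h2 h3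
    rw [h2, h3]
    exact h1

theorem seqClosed_fiber {Ω : Type*} [MeasurableSpace Ω] {P : Measure Ω}
    {B : Type*} [NormedAddCommGroup B]
    (K : Ω → Set B) (hK : ∀ ω, IsClosed (K ω)) :
    SeqClosed {y : Ω →ₘ[P] B | ∀ᵐ ω ∂P, y ω ∈ K ω} := by
  intro x y hx hy
  obtain ⟨ns, -, hns⟩ := hy.exists_seq_tendsto_ae
  have hx' : ∀ᵐ ω ∂P, ∀ n, x n ω ∈ K ω := ae_all_iff.2 hx
  show ∀ᵐ ω ∂P, y ω ∈ K ω
  filter_upwards [hns, hx'] with ω h1 h2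
  exact (hK ω).mem_of_tendsto h1 (Eventually.of_forall fun n => h2 _)

theorem lconvex_fiber {Ω : Type*} [MeasurableSpace Ω] {P : Measure Ω}
    {B : Type*} [NormedAddCommGroup B] [NormedSpace ℝ B]
    (K : Ω → Set B) (hK : ∀ ω, Convex ℝ (K ω)) :
    LConvex {y : Ω →ₘ[P] B | ∀ᵐ ω ∂P, y ω ∈ K ω} := by
  intro x hx y hy l h0 h1
  show ∀ᵐ ω ∂P, (msmul l x + msmul (1 - l) y : Ω →ₘ[P] B) ω ∈ K ω
  have hx' : ∀ᵐ ω ∂P, x ω ∈ K ω := hx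
  have hy' : ∀ᵐ ω ∂P, y ω ∈ K ω := hy
  have e1 : ∀ᵐ ω ∂P, msmul l x ω = l ω • x ω :=
    AEEqFun.coeFn_comp₂ _ continuous_smul l x
  have e2 : ∀ᵐ ω ∂P, msmul (1 - l) y ω = (1 - l : Ω →ₘ[P] ℝ) ω • y ω :=
    AEEqFun.coeFn_comp₂ _ continuous_smul (1 - l) y
  filter_upwards [hx', hy', e1, e2, AEEqFun.coeFn_add (msmul l x) (msmul (1 - l) y),
    AEEqFun.coeFn_sub (1 : Ω →ₘ[P] ℝ) l, AEEqFun.coeFn_one (α := Ω) (μ := P) (β := ℝ),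
    AEEqFun.coeFn_zero (α := Ω) (μ := P) (β := ℝ),
    AEEqFun.coeFn_le.2 h0, AEEqFun.coeFn_le.2 h1] with ω a b c d e f g h i j
  rw [e, Pi.add_apply, c, d, f, Pi.sub_apply, g, Pi.one_apply]
  rw [h, Pi.zero_apply] at i
  rw [g, Pi.one_apply] at j
  exact hK ω a b i (by linarith) (by ring)

theorem lsup_eq {Ω : Type*} [MeasurableSpace Ω] {P : Measure Ω}
    (S : Set (Ω →ₘ[P] ℝ)) (c : Ω →ₘ[P] ℝ) (h : IsLUB S c) : lsup S = c := by
  have hex : ∃ ξ, IsLUB S ξ := ⟨c, h⟩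
  unfold lsup
  rw [dif_pos hex]
  exact hex.choose_spec.unique h

theorem sum_coe {Ω : Type*} [MeasurableSpace Ω] {P : Measure Ω}
    {B : Type*} [NormedAddCommGroup B] (x : ℕ → Ω →ₘ[P] B) (s : Finset ℕ) :
    ∀ᵐ ω ∂P, (∑ i ∈ s, x i : Ω →ₘ[P] B) ω = ∑ i ∈ s, x i ω := by
  induction s using Finset.induction_on with
  | empty =>
    filter_upwards [AEEqFun.coeFn_zero (α := Ω) (μ := P) (β := B)] with ω h
    simpa using h
  | insert a s ha ih =>
    rw [Finset.sum_insert ha]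
    filter_upwards [ih, AEEqFun.coeFn_add (x a) (∑ i ∈ s, x i)] with ω h1 h2
    rw [h2, Pi.add_apply, h1, Finset.sum_insert ha]

/-- The closed `L⁰`-convex hull of `{x n | n ≥ 1}`. -/
def hullSeq {Ω : Type*} [MeasurableSpace Ω] {P : Measure Ω}
    {B : Type*} [NormedAddCommGroup B] [NormedSpace ℝ B] (x : ℕ → Ω →ₘ[P] B) :
    Set (Ω →ₘ[P] B) :=
  ⋂₀ {S | SeqClosed S ∧ LConvex S ∧ ∀ n, 1 ≤ n → x n ∈ S}

theorem hullSeq_fiber {Ω : Type*} [MeasurableSpace Ω] {P : Measure Ω}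
    {B : Type*} [NormedAddCommGroup B] [NormedSpace ℝ B] (x : ℕ → Ω →ₘ[P] B)
    (K : Ω → Set B) (hK : ∀ ω, IsClosed (K ω)) (hK' : ∀ ω, Convex ℝ (K ω))
    (hx : ∀ n, 1 ≤ n → ∀ᵐ ω ∂P, x n ω ∈ K ω) (y : Ω →ₘ[P] B) (hy : y ∈ hullSeq x) :
    ∀ᵐ ω ∂P, y ω ∈ K ω :=
  hy _ ⟨seqClosed_fiber K hK, lconvex_fiber K hK', hx⟩

/-- The pointwise set of points `b` asymptotically within `(n-1)c` of `w n`. -/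
def asymSet {B : Type*} [NormedAddCommGroup B] (w : ℕ → B) (c : ℝ) : Set B :=
  {b | ∀ ε > 0, ∀ᶠ n : ℕ in atTop, ‖b - w n‖ ≤ ((n : ℝ) - 1) * c + ε}

theorem asymSet_closed {B : Type*} [NormedAddCommGroup B] (w : ℕ → B) (c : ℝ) :
    IsClosed (asymSet w c) := by
  rw [← isSeqClosed_iff_isClosed]
  intro b y hb hy ε hε
  obtain ⟨k, hk⟩ := ((Metric.tendsto_nhds.1 hy) (ε / 2) (by positivity)).exists
  rw [dist_comm, dist_eq_norm] at hk
  filter_upwards [hb k (ε / 2) (by positivity)] with n hn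
  have := norm_add_le (y - b k) (b k - w n)
  rw [sub_add_sub_cancel] at this
  linarith

theorem asymSet_convex {B : Type*} [NormedAddCommGroup B] [NormedSpace ℝ B]
    (w : ℕ → B) (c : ℝ) : Convex ℝ (asymSet w c) := by
  intro b hb b' hb' s t hs ht hst ε hε
  filter_upwards [hb ε hε, hb' ε hε] with n h1 h2
  have := convex_closedBall (w n) (((n : ℝ) - 1) * c + ε) (mem_closedBall_iff_norm.2 h1)
    (mem_closedBall_iff_norm.2 h2) hs ht hst
  exact mem_closedBall_iff_norm.1 this

theorem asymSet_mem {B : Type*} [NormedAddCommGroup B] (x : ℕ → B) (c : ℝ)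
    (h : ∀ n m, 1 ≤ n → 1 ≤ m → ‖x n - x m‖ ≤ c) (i : ℕ) (hi : 1 ≤ i) :
    x i ∈ asymSet (fun n => x (n + 1) + ∑ j ∈ Finset.Icc 1 n, (x j - x (n + 1))) c := by
  intro ε hε
  filter_upwards [eventually_ge_atTop i] with n hn
  have hmem : i ∈ Finset.Icc 1 n := Finset.mem_Icc.2 ⟨hi, hn⟩
  rw [← Finset.add_sum_erase _ _ hmem]
  have e : x i - (x (n + 1) + (x i - x (n + 1) +
      ∑ j ∈ (Finset.Icc 1 n).erase i, (x j - x (n + 1)))) =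
      - ∑ j ∈ (Finset.Icc 1 n).erase i, (x j - x (n + 1)) := by abel
  rw [e, norm_neg]
  have h2 : ‖∑ j ∈ (Finset.Icc 1 n).erase i, (x j - x (n + 1))‖ ≤
      ∑ j ∈ (Finset.Icc 1 n).erase i, c := by
    refine norm_sum_le_of_le _ fun j hj => h _ _ ?_ (by omega)
    exact (Finset.mem_Icc.1 (Finset.mem_of_mem_erase hj)).1
  rw [Finset.sum_const, Finset.card_erase_of_mem hmem, Nat.card_Icc, nsmul_eq_mul,
    Nat.add_sub_cancel, Nat.cast_sub (hi.trans hn), Nat.cast_one] at h2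
  linarith

/-- Pointwise estimate: a point of the asymptotic set is at distance nearly `c` from `x (n+1)`. -/
theorem asymSet_bound {B : Type*} [NormedAddCommGroup B] [NormedSpace ℝ B] (x : ℕ → B) (c r : ℝ)
    (hlb : ∀ n : ℕ, 1 ≤ n →
      c - 1 / (n : ℝ) ^ 2 ≤ ‖x (n + 1) - (n : ℝ)⁻¹ • ∑ i ∈ Finset.Icc 1 n, x i‖)
    (z : B) (hz : z ∈ asymSet
      (fun n => x (n + 1) + ∑ j ∈ Finset.Icc 1 n, (x j - x (n + 1))) c)
    (hr : ∀ n, 1 ≤ n → ‖z - x n‖ ≤ r) : c ≤ r := by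
  refine le_of_forall_pos_le_add fun ε hε => ?_
  have h1 : ∀ᶠ n : ℕ in atTop, 1 / (n : ℝ) < ε / 2 :=
    tendsto_one_div_atTop_nhds_zero_nat.eventually_lt_const (by positivity)
  obtain ⟨n, hn1, hn2, hn3⟩ :=
    (h1.and ((hz (ε / 2) (by positivity)).and (eventually_ge_atTop 1))).exists
  have hn0 : (0 : ℝ) < n := by exact_mod_cast hn3
  have a := hlb n hn3
  set S : B := ∑ j ∈ Finset.Icc 1 n, (x j - x (n + 1)) with hS
  have e : x (n + 1) - (n : ℝ)⁻¹ • ∑ i ∈ Finset.Icc 1 n, x i = (n : ℝ)⁻¹ • (-S) := by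
    rw [hS, Finset.sum_sub_distrib, Finset.sum_const, Nat.card_Icc, Nat.add_sub_cancel,
      ← Nat.cast_smul_eq_nsmul ℝ, neg_sub, smul_sub, smul_smul, inv_mul_cancel₀ hn0.ne', one_smul]
  rw [e, norm_smul, norm_neg, Real.norm_of_nonneg (by positivity)] at a
  have a2 : (n : ℝ) * c - 1 / n ≤ ‖S‖ := by
    have := mul_le_mul_of_nonneg_left a hn0.le
    have e1 : (n : ℝ) * (c - 1 / (n : ℝ) ^ 2) = n * c - 1 / n := by field_simp
    have e2 : (n : ℝ) * ((n : ℝ)⁻¹ * ‖S‖) = ‖S‖ := by field_simp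
    rw [e1, e2] at this
    exact this
  have b := norm_sub_le (z - x (n + 1)) (z - (x (n + 1) + S))
  have e3 : (z - x (n + 1)) - (z - (x (n + 1) + S)) = S := by abel
  rw [e3] at b
  have := hr (n + 1) (by omega)
  have hn2' : ‖z - (x (n + 1) + S)‖ ≤ ((n : ℝ) - 1) * c + ε / 2 := hn2
  linarith

/-- If a nonempty closed `L⁰`-convex `G` contains a sequence `(x_n)_{n ≥ 1}` with
`‖x_n − x_m‖ ≤ c`, `‖x_{n+1} − x̄_n‖ ≥ c − 1/n²` for some `c > 0` a.s., where
`x̄_n = (1/n)·Σ_{i=1}^n x_i`, then `G` does not have random normal structure. -/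
theorem not_randNormalStructure_of_diametral_sequence
    {Ω : Type*} [MeasurableSpace Ω] {P : Measure Ω} [IsProbabilityMeasure P]
    {B : Type*} [NormedAddCommGroup B] [NormedSpace ℝ B] [CompleteSpace B]
    (G : Set (Ω →ₘ[P] B)) (hGne : G.Nonempty) (hGcl : SeqClosed G) (hGcv : LConvex G)
    (x : ℕ → Ω →ₘ[P] B) (hxG : ∀ n, 1 ≤ n → x n ∈ G)
    (c : Ω →ₘ[P] ℝ) (hc : ∀ᵐ ω ∂P, 0 < c ω)
    (hbd : ∀ n m : ℕ, 1 ≤ n → 1 ≤ m → nrm (x n - x m) ≤ c)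
    (hlb : ∀ n : ℕ, 1 ≤ n →
      c - AEEqFun.const Ω (1 / (n : ℝ) ^ 2) ≤
        nrm (x (n + 1) - (n : ℝ)⁻¹ • ∑ i ∈ Finset.Icc 1 n, x i)) :
    ¬ RandNormalStructure G := by
  intro hG
  have hxH : ∀ n, 1 ≤ n → x n ∈ hullSeq x := fun n hn S hS => hS.2.2 n hn
  have hHG : hullSeq x ⊆ G := fun y hy => hy G ⟨hGcl, hGcv, hxG⟩
  have hHcl : SeqClosed (hullSeq x) := fun u y hu hy S hS =>
    hS.1 u y (fun n => hu n S hS) hy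
  have hHcv : LConvex (hullSeq x) := fun u hu v hv l h0 h1 S hS =>
    hS.2.1 u (hu S hS) v (hv S hS) l h0 h1
  have hbd' : ∀ n m : ℕ, 1 ≤ n → 1 ≤ m → ∀ᵐ ω ∂P, ‖x n ω - x m ω‖ ≤ c ω :=
    fun n m hn hm => (nrm_sub_le_iff _ _ _).1 (hbd n m hn hm)
  have hd1 : ∀ y ∈ hullSeq x, ∀ n, 1 ≤ n → ∀ᵐ ω ∂P, ‖y ω - x n ω‖ ≤ c ω := by
    intro y hy n hn
    have := hullSeq_fiber x (fun ω => Metric.closedBall (x n ω) (c ω))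
      (fun ω => Metric.isClosed_closedBall) (fun ω => convex_closedBall _ _)
      (fun m hm => by
        filter_upwards [hbd' m n hm hn] with ω h
        exact mem_closedBall_iff_norm.2 h) y hy
    filter_upwards [this] with ω h
    exact mem_closedBall_iff_norm.1 h
  have hd2 : ∀ y ∈ hullSeq x, ∀ z ∈ hullSeq x, nrm (y - z) ≤ c := by
    intro y hy z hz
    rw [nrm_sub_le_iff]
    have := hullSeq_fiber x (fun ω => Metric.closedBall (z ω) (c ω))
      (fun ω => Metric.isClosed_closedBall) (fun ω => convex_closedBall _ _)
      (fun m hm => by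
        filter_upwards [hd1 z hz m hm] with ω h
        rw [mem_closedBall_iff_norm, norm_sub_rev]
        exact h) y hy
    filter_upwards [this] with ω h
    exact mem_closedBall_iff_norm.1 h
  have hall : ∀ᵐ ω ∂P, ∀ n m : ℕ, 1 ≤ n → 1 ≤ m → ‖x n ω - x m ω‖ ≤ c ω := by
    simp only [ae_all_iff]
    exact hbd'
  have hlb' : ∀ᵐ ω ∂P, ∀ n : ℕ, 1 ≤ n → c ω - 1 / (n : ℝ) ^ 2 ≤
      ‖x (n + 1) ω - (n : ℝ)⁻¹ • ∑ i ∈ Finset.Icc 1 n, x i ω‖ := by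
    simp only [ae_all_iff]
    intro n hn
    filter_upwards [AEEqFun.coeFn_le.2 (hlb n hn),
      AEEqFun.coeFn_sub c (AEEqFun.const Ω (1 / (n : ℝ) ^ 2)),
      AEEqFun.coeFn_const (μ := P) Ω (1 / (n : ℝ) ^ 2),
      nrm_coe (x (n + 1) - (n : ℝ)⁻¹ • ∑ i ∈ Finset.Icc 1 n, x i),
      AEEqFun.coeFn_sub (x (n + 1)) ((n : ℝ)⁻¹ • ∑ i ∈ Finset.Icc 1 n, x i),
      AEEqFun.coeFn_smul (n : ℝ)⁻¹ (∑ i ∈ Finset.Icc 1 n, x i),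
      sum_coe x (Finset.Icc 1 n)] with ω h1 h2 h3 h4 h5 h6 h7
    rw [h2, Pi.sub_apply, h3, h4, h5, Pi.sub_apply, h6, Pi.smul_apply, h7] at h1
    exact h1
  have hub : ∀ z ∈ hullSeq x, ∀ ξ : Ω →ₘ[P] ℝ,
      (∀ y ∈ hullSeq x, nrm (z - y) ≤ ξ) → c ≤ ξ := by
    intro z hz ξ hξ
    rw [← AEEqFun.coeFn_le]
    have h1 : ∀ᵐ ω ∂P, ∀ n, 1 ≤ n → ‖z ω - x n ω‖ ≤ ξ ω := by
      simp only [ae_all_iff]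
      exact fun n hn => (nrm_sub_le_iff _ _ _).1 (hξ _ (hxH n hn))
    have h2 := hullSeq_fiber x (fun ω => asymSet
      (fun n => x (n + 1) ω + ∑ j ∈ Finset.Icc 1 n, (x j ω - x (n + 1) ω)) (c ω))
      (fun ω => asymSet_closed _ _) (fun ω => asymSet_convex _ _)
      (fun m hm => by
        filter_upwards [hall] with ω h
        exact asymSet_mem (fun n => x n ω) (c ω) h m hm) z hz
    filter_upwards [h1, h2, hlb'] with ω a b d
    exact asymSet_bound (fun n => x n ω) (c ω) (ξ ω) d (z ω) b a
  have hR : ∀ z ∈ hullSeq x, Rr (hullSeq x) z = c := by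
    intro z hz
    refine lsup_eq _ _ ⟨?_, ?_⟩
    · rintro _ ⟨y, hy, rfl⟩
      exact hd2 z hz y hy
    · intro ξ hξ
      exact hub z hz ξ fun y hy => hξ ⟨y, hy, rfl⟩
  have hx1 := hxH 1 le_rfl
  have hD : Dd (hullSeq x) = c := by
    refine lsup_eq _ _ ⟨?_, ?_⟩
    · rintro _ ⟨y, hy, z, hz, rfl⟩
      exact hd2 y hy z hz
    · intro ξ hξ
      exact hub (x 1) hx1 ξ fun y hy => hξ ⟨x 1, hx1, y, hy, rfl⟩
  have hB : ASBounded (hullSeq x) := by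
    refine ⟨nrm (x 1) + c, fun h hh => ?_⟩
    rw [← AEEqFun.coeFn_le]
    filter_upwards [hd1 h hh 1 le_rfl, nrm_coe h, nrm_coe (x 1),
      AEEqFun.coeFn_add (nrm (x 1)) c] with ω h1 h2 h3 h4
    rw [h2, h4, Pi.add_apply, h3]
    have := norm_add_le (x 1 ω) (h ω - x 1 ω)
    rw [add_sub_cancel] at this
    linarith
  have hD0 : Dd (hullSeq x) ≠ 0 := by
    rw [hD]
    rintro rfl
    obtain ⟨ω, h1, h2⟩ := (hc.and (AEEqFun.coeFn_zero (α := Ω) (μ := P) (β := ℝ))).exists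
    rw [h2] at h1
    exact lt_irrefl _ h1
  obtain ⟨z, hz, h⟩ := hG _ hHG ⟨_, hx1⟩ hB hHcl hHcv hD0
  rw [hD, hR z hz] at h
  obtain ⟨ω, h1, h2⟩ := (hc.and h).exists
  exact lt_irrefl _ (h2 h1)

end RNM
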